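/- Let 𝐢 be a Lyndon word and m a positive integer. Then max(𝐢^m ⋄ 𝐢) = 𝐢^{m+1}, and the coefficient of the word 𝐢^{m+1} in 𝐢^m ⋄ 𝐢 equals (−1)^{p(m𝐢)} q_𝐢^{−m} [m+1]_𝐢. -/

import Mathlib

namespace SpinQHA

/-- The coefficient field `ℚ(q)`. -/
abbrev Kq : Type := RatFunc ℚ

/-- The variable `q`. -/
noncomputable def qX : Kq := RatFunc.X

/-- Parity of the letter `i`.  The alphabet is `Fin (n+2)` (so the rank is `n+2 ≥ 2`);
the index `i` represents the letter `i+1`, and the last letter is the unique odd one. -/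
def pa (n : ℕ) (i : Fin (n+2)) : ℕ := if (i : ℕ) = n+1 then 1 else 0

/-- Symmetrized Cartan matrix of `osp(1|2(n+2))`. -/
def cart (n : ℕ) (i j : Fin (n+2)) : ℤ :=
  if i = j then (if (i : ℕ) = n+1 then 2 else 4)
  else if (i : ℕ) + 1 = (j : ℕ) ∨ (j : ℕ) + 1 = (i : ℕ) then -2 else 0

/-- Bilinear form on `Q⁺` (elements recorded by their coordinates). -/
def bil (n : ℕ) (μ ν : Fin (n+2) → ℕ) : ℤ :=
  ∑ i, ∑ j, (μ i : ℤ) * (ν j : ℤ) * cart n i j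

/-- Weight `|w| ∈ Q⁺` of a word. -/
def wt (n : ℕ) (w : List (Fin (n+2))) : Fin (n+2) → ℕ := fun i => w.count i

/-- Parity (as a natural number, read mod 2) of a word. -/
def pw (n : ℕ) (w : List (Fin (n+2))) : ℕ := (w.map (pa n)).sum

/-- `F`, the free `ℚ(q)`-module on the set of words. -/
abbrev F (n : ℕ) : Type := List (Fin (n+2)) →₀ Kq

/-- Quantum shuffle of two words, computed in the "reversed" representation where the
head of each list is the *last* letter of the corresponding word; this encodes the
inductive rule `(xi) ⋄ (yj) = (x ⋄ (yj))i + (-1)^{p(xi)p(j)} q^{-(|xi|,|j|)} ((xi) ⋄ y)j`. -/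
noncomputable def shAux (n : ℕ) : List (Fin (n+2)) → List (Fin (n+2)) → F n
  | [], y => Finsupp.single y 1
  | x, [] => Finsupp.single x 1
  | i :: x, j :: y =>
      Finsupp.mapDomain (List.cons i) (shAux n x (j :: y))
      + ((-1 : Kq) ^ (pw n (i :: x) * pa n j)
          * qX ^ (-(bil n (wt n (i :: x)) (wt n [j])))) •
          Finsupp.mapDomain (List.cons j) (shAux n (i :: x) y)
  termination_by x y => x.length + y.length

/-- Quantum shuffle product of two words. -/
noncomputable def shw (n : ℕ) (x y : List (Fin (n+2))) : F n :=
  Finsupp.mapDomain List.reverse (shAux n x.reverse y.reverse)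

/-- The quantum shuffle product `⋄` on `F`, extended bilinearly. -/
noncomputable def diam (n : ℕ) (u v : F n) : F n :=
  u.sum fun x cx => v.sum fun y cy => (cx * cy) • shw n x y

/-- Strict lexicographic order `≺` on words. -/
def wlt (n : ℕ) (v w : List (Fin (n+2))) : Prop := List.Lex (· < ·) v w

/-- A word is Lyndon if it is nonempty and lexicographically smaller than each of its
proper nonempty suffixes. -/
def IsLyndonW (n : ℕ) (w : List (Fin (n+2))) : Prop :=
  w ≠ [] ∧ ∀ s t : List (Fin (n+2)), w = s ++ t → s ≠ [] → t ≠ [] → wlt n w t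

/-- Iterated shuffle products of one-letter words. -/
noncomputable def prodLetters (n : ℕ) : List (Fin (n+2)) → F n
  | [] => Finsupp.single [] 1
  | i :: l => diam n (Finsupp.single [i] 1) (prodLetters n l)

/-- `U`, the subalgebra of `(F,⋄)` generated by the one-letter words, realized as the
`ℚ(q)`-span of all iterated shuffle products of letters. -/
noncomputable def Ualg (n : ℕ) : Submodule Kq (F n) :=
  Submodule.span Kq (Set.range (prodLetters n))

/-- `w = max(u)`: `w` is the lexicographically largest word occurring in `u` with
nonzero coefficient. -/
def IsMaxWord (n : ℕ) (u : F n) (w : List (Fin (n+2))) : Prop :=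
  w ∈ u.support ∧ ∀ v ∈ u.support, v = w ∨ wlt n v w

/-- A word is dominant if it is the largest word of some `u ∈ U`. -/
def IsDominant (n : ℕ) (w : List (Fin (n+2))) : Prop :=
  ∃ u ∈ Ualg n, IsMaxWord n u w

/-- The `m`-fold concatenation `w^m` of a word. -/
def rep (n : ℕ) (m : ℕ) (w : List (Fin (n+2))) : List (Fin (n+2)) :=
  (List.replicate m w).flatten

/-- `q_𝐢 = q^{(|𝐢|,|𝐢|)/2}`. -/
noncomputable def qI (n : ℕ) (w : List (Fin (n+2))) : Kq :=
  qX ^ ((bil n (wt n w) (wt n w)) / 2)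

/-- The (signed) quantum integer `[m]_𝐢`:
`[m]_𝐢 = (q_𝐢^m - q_𝐢^{-m})/(q_𝐢 - q_𝐢^{-1})` if `p(𝐢) = 0̄`, and
`[m]_𝐢 = ((-q_𝐢)^m - q_𝐢^{-m})/(-q_𝐢 - q_𝐢^{-1})` if `p(𝐢) = 1̄`. -/
noncomputable def qint (n : ℕ) (w : List (Fin (n+2))) (m : ℕ) : Kq :=
  if pw n w % 2 = 0 then
    (qI n w ^ m - (qI n w)⁻¹ ^ m) / (qI n w - (qI n w)⁻¹)
  else
    ((-qI n w) ^ m - (qI n w)⁻¹ ^ m) / (-qI n w - (qI n w)⁻¹)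

/-- The quantum factorial `[m]_𝐢! = [m]_𝐢 [m-1]_𝐢 ⋯ [1]_𝐢`. -/
noncomputable def qfact (n : ℕ) (w : List (Fin (n+2))) : ℕ → Kq
  | 0 => 1
  | m + 1 => qint n w (m+1) * qfact n w m

section DiscountedSum

variable {α : Type*}

/-- The discounted sum `c a₀ + β c a₁ + β² c a₂ + ⋯` of the weights of the letters of a word. -/
def discSum (β : ℚ) (c : α → ℚ) : List α → ℚ
  | [] => 0
  | a :: l => c a + β * discSum β c l

/-- The largest discounted sum of a (possibly empty) prefix of a word. -/
def discMax (β : ℚ) (c : α → ℚ) : List α → ℚ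
  | [] => 0
  | a :: l => max 0 (c a + β * discMax β c l)

theorem discSum_append (β : ℚ) (c : α → ℚ) (x y : List α) :
    discSum β c (x ++ y) = discSum β c x + β ^ x.length * discSum β c y := by
  induction x with
  | nil => simp [discSum]
  | cons a x ih => simp only [List.cons_append, discSum, ih, List.length_cons, pow_succ]; ring

theorem discMax_nonneg (β : ℚ) (c : α → ℚ) (l : List α) : 0 ≤ discMax β c l := by
  cases l <;> simp [discMax]

theorem exists_prefix_discMax_eq (β : ℚ) (c : α → ℚ) (l : List α) :
    ∃ l', l' <+: l ∧ discMax β c l = discSum β c l' := by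
  induction l with
  | nil => exact ⟨[], List.prefix_rfl, rfl⟩
  | cons a l ih =>
    obtain ⟨l', hl, h⟩ := ih
    rcases max_choice 0 (c a + β * discMax β c l) with hm | hm
    · exact ⟨[], List.nil_prefix, by simpa [discMax, discSum] using hm⟩
    · exact ⟨a :: l', by simpa using hl, by rw [discMax, hm, h, discSum]⟩

theorem discSum_sub_const (β : ℚ) (c : α → ℚ) (t : ℚ) (l : List α) :
    discSum β (fun a => c a - t) l = discSum β c l - t * discSum β (fun _ => 1) l := by
  induction l with
  | nil => simp [discSum]
  | cons a l ih => simp only [discSum, ih]; ring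

theorem discSum_one_nonneg {β : ℚ} (hβ : 0 ≤ β) (l : List α) :
    0 ≤ discSum β (fun _ => 1) l := by
  induction l with
  | nil => simp [discSum]
  | cons a l ih => simp only [discSum]; positivity

theorem discSum_one_pos {β : ℚ} (hβ : 0 ≤ β) {l : List α} (hl : l ≠ []) :
    0 < discSum β (fun _ => 1) l := by
  cases l with
  | nil => exact absurd rfl hl
  | cons a l =>
    have := discSum_one_nonneg hβ l
    simp only [discSum]; positivity

end DiscountedSum

section Lex

variable {α : Type*} [LinearOrder α]

theorem lex_append_of_length_le {w t : List α} (h : List.Lex (· < ·) w t)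
    (hl : t.length ≤ w.length) (u v : List α) : List.Lex (· < ·) (w ++ u) (t ++ v) := by
  induction h with
  | nil => simp at hl
  | rel h => exact List.Lex.rel h
  | cons _ ih => exact List.Lex.cons (ih (by simpa using hl))

theorem eq_or_lex_or_lex {u v : List α} (h : u.length = v.length) :
    u = v ∨ List.Lex (· < ·) u v ∨ List.Lex (· < ·) v u := by
  induction u generalizing v with
  | nil => left; exact (List.length_eq_zero_iff.mp h.symm).symm
  | cons a u ih =>
    cases v with
    | nil => simp at h
    | cons b v =>
      rcases lt_trichotomy a b with hab | rfl | hab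
      · exact .inr (.inl (.rel hab))
      · rcases ih (by simpa using h) with rfl | h' | h'
        · exact .inl rfl
        · exact .inr (.inl (.cons h'))
        · exact .inr (.inr (.cons h'))
      · exact .inr (.inr (.rel hab))

end Lex

theorem discSum_sub_le (n : ℕ) (t : ℚ) {u v : List (Fin (n+2))} (h : u.length = v.length) :
    discSum (n+3 : ℚ)⁻¹ (fun a : Fin (n+2) => ((a : ℕ) : ℚ) - t) u - discSum (n+3 : ℚ)⁻¹ (fun a : Fin (n+2) => ((a : ℕ) : ℚ) - t) v
      ≤ (n+1) * (n+3) / (n+2) := by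
  induction u generalizing v with
  | nil =>
    rw [List.length_eq_zero_iff.mp h.symm, sub_self]; positivity
  | cons a u ih =>
    cases v with
    | nil => simp at h
    | cons b v =>
      have h1 := ih (v := v) (by simpa using h)
      have h2 : (((a : ℕ) : ℚ)) ≤ n + 1 := by exact_mod_cast Nat.lt_succ_iff.mp a.2
      have h3 : (0 : ℚ) ≤ ((b : ℕ) : ℚ) := by positivity
      have h4 := mul_le_mul_of_nonneg_left h1 (by positivity : (0 : ℚ) ≤ (n+3 : ℚ)⁻¹)
      have h5 : (n+3 : ℚ)⁻¹ * ((n+1) * (n+3) / (n+2)) = (n+1) * (n+3) / (n+2) - (n + 1) := by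
        field_simp; ring
      simp only [discSum]
      linarith

theorem discSum_lt_of_lex (n : ℕ) (t : ℚ) {u v : List (Fin (n+2))} (hl : u.length = v.length)
    (h : List.Lex (· < ·) u v) :
    discSum (n+3 : ℚ)⁻¹ (fun a : Fin (n+2) => ((a : ℕ) : ℚ) - t) u
      < discSum (n+3 : ℚ)⁻¹ (fun a : Fin (n+2) => ((a : ℕ) : ℚ) - t) v := by
  induction h with
  | nil => simp at hl
  | @rel a u b v h =>
    have h1 := discSum_sub_le n t (u := u) (v := v) (by simpa using hl)
    have h2 : (((a : ℕ) : ℚ)) + 1 ≤ ((b : ℕ) : ℚ) := by exact_mod_cast h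
    have h4 := mul_le_mul_of_nonneg_left h1 (by positivity : (0 : ℚ) ≤ (n+3 : ℚ)⁻¹)
    have h5 : (n+3 : ℚ)⁻¹ * ((n+1) * (n+3) / (n+2)) < 1 := by
      have : (n+3 : ℚ)⁻¹ * ((n+1) * (n+3) / (n+2)) = (n+1) / (n+2) := by field_simp
      rw [this, div_lt_one (by positivity)]; linarith
    simp only [discSum]
    linarith
  | cons _ ih =>
    simp only [discSum]
    have := ih (by simpa using hl)
    gcongr

/-- For a Lyndon word `w`, the letters can be weighted so that discounted sums are strictly
monotone on words of equal length, vanish on `w` and are positive on its proper suffixes. -/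
theorem IsLyndonW.exists_weight {n : ℕ} {w : List (Fin (n+2))} (hw : IsLyndonW n w) :
    ∃ (β : ℚ) (c : Fin (n+2) → ℚ), 0 < β ∧ β < 1 ∧ discSum β c w = 0 ∧
      (∀ s t, w = s ++ t → s ≠ [] → t ≠ [] → 0 < discSum β c t) ∧
      ∀ u v : List (Fin (n+2)), u.length = v.length → wlt n u v →
        discSum β c u < discSum β c v := by
  set β : ℚ := (n+3 : ℚ)⁻¹
  have hβ0 : 0 < β := by positivity
  have hβ1 : β < 1 := inv_lt_one_of_one_lt₀ (by linarith [(Nat.cast_nonneg n : (0 : ℚ) ≤ n)])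
  set t₀ : ℚ := discSum β (fun a : Fin (n+2) => ((a : ℕ) : ℚ)) w / discSum β (fun _ => 1) w
  have hmono : ∀ u v : List (Fin (n+2)), u.length = v.length → wlt n u v →
      discSum β (fun a : Fin (n+2) => ((a : ℕ) : ℚ) - t₀) u < discSum β (fun a : Fin (n+2) => ((a : ℕ) : ℚ) - t₀) v :=
    fun u v hl h => discSum_lt_of_lex n t₀ hl h
  have hzero : discSum β (fun a : Fin (n+2) => ((a : ℕ) : ℚ) - t₀) w = 0 := by
    rw [discSum_sub_const, div_mul_cancel₀ _ (discSum_one_pos hβ0.le hw.1).ne', sub_self]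
  refine ⟨β, fun a => ((a : ℕ) : ℚ) - t₀, hβ0, hβ1, hzero, ?_, hmono⟩
  intro s t hst hs ht
  have hlen : t.length ≤ w.length := by simp [hst]
  have h := hmono (w ++ t) (t ++ w) (by simp [add_comm])
    (lex_append_of_length_le (hw.2 s t hst hs ht) hlen t w)
  rw [discSum_append, discSum_append, hzero, zero_add, mul_zero, add_zero] at h
  have hpow : β ^ w.length < 1 :=
    pow_lt_one₀ hβ0.le hβ1 (by simpa using hw.1)
  by_contra! hneg
  nlinarith

theorem wt_append (n : ℕ) (x y : List (Fin (n+2))) : wt n (x ++ y) = wt n x + wt n y := by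
  funext k; simp [wt]

theorem wt_reverse (n : ℕ) (x : List (Fin (n+2))) : wt n x.reverse = wt n x := by
  funext k; simp [wt]

theorem pw_append (n : ℕ) (x y : List (Fin (n+2))) : pw n (x ++ y) = pw n x + pw n y := by
  simp [pw]

theorem pw_reverse (n : ℕ) (x : List (Fin (n+2))) : pw n x.reverse = pw n x := by
  simp [pw]

theorem bil_add_left (n : ℕ) (μ μ' ν : Fin (n+2) → ℕ) :
    bil n (μ + μ') ν = bil n μ ν + bil n μ' ν := by
  simp [bil, add_mul, Finset.sum_add_distrib]

theorem bil_add_right (n : ℕ) (μ ν ν' : Fin (n+2) → ℕ) :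
    bil n μ (ν + ν') = bil n μ ν + bil n μ ν' := by
  simp [bil, add_mul, mul_add, Finset.sum_add_distrib]

theorem qX_ne_zero : qX ≠ 0 := RatFunc.X_ne_zero

/-- The scalar `(-1)^{p(x)p(y)} q^{-(|x|,|y|)}` picked up when `x` is moved in front of `y`. -/
noncomputable def cst (n : ℕ) (x y : List (Fin (n+2))) : Kq :=
  (-1 : Kq) ^ (pw n x * pw n y) * qX ^ (-(bil n (wt n x) (wt n y)))

theorem cst_append_left (n : ℕ) (x x' y : List (Fin (n+2))) :
    cst n (x ++ x') y = cst n x y * cst n x' y := by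
  simp only [cst, wt_append, pw_append, bil_add_left, add_mul, pow_add, neg_add,
    zpow_add₀ qX_ne_zero]
  ring

theorem cst_append_right (n : ℕ) (x y y' : List (Fin (n+2))) :
    cst n x (y ++ y') = cst n x y * cst n x y' := by
  simp only [cst, wt_append, pw_append, bil_add_right, mul_add, pow_add, neg_add,
    zpow_add₀ qX_ne_zero]
  ring

theorem cst_cons_left (n : ℕ) (a : Fin (n+2)) (x y : List (Fin (n+2))) :
    cst n (a :: x) y = cst n [a] y * cst n x y :=
  cst_append_left n [a] x y

theorem cst_cons_right (n : ℕ) (a : Fin (n+2)) (x y : List (Fin (n+2))) :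
    cst n x (a :: y) = cst n x [a] * cst n x y :=
  cst_append_right n x [a] y

theorem cst_nil_left (n : ℕ) (y : List (Fin (n+2))) : cst n [] y = 1 := by
  simp [cst, pw, wt, bil]

theorem cst_reverse_right (n : ℕ) (x y : List (Fin (n+2))) : cst n x y.reverse = cst n x y := by
  simp [cst, pw_reverse, wt_reverse]

theorem shAux_nil_left (n : ℕ) (y : List (Fin (n+2))) :
    shAux n [] y = Finsupp.single y 1 := by
  rw [shAux]

theorem shAux_nil_right (n : ℕ) (x : List (Fin (n+2))) :
    shAux n x [] = Finsupp.single x 1 := by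
  cases x <;> simp [shAux]

theorem shAux_cons_cons (n : ℕ) (i j : Fin (n+2)) (x y : List (Fin (n+2))) :
    shAux n (i :: x) (j :: y) =
      Finsupp.mapDomain (List.cons i) (shAux n x (j :: y))
      + cst n (i :: x) [j] • Finsupp.mapDomain (List.cons j) (shAux n (i :: x) y) := by
  rw [shAux]
  simp [cst, pw]

theorem shAux_append_append (n : ℕ) (i j : Fin (n+2)) (x y : List (Fin (n+2))) :
    shAux n (x ++ [i]) (y ++ [j]) =
      cst n [i] (y ++ [j]) • Finsupp.mapDomain (· ++ [i]) (shAux n x (y ++ [j]))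
      + Finsupp.mapDomain (· ++ [j]) (shAux n (x ++ [i]) y) := by
  induction x generalizing y with
  | nil =>
    induction y with
    | nil =>
      simp [shAux_cons_cons, shAux_nil_left, shAux_nil_right, Finsupp.mapDomain_single, add_comm]
    | cons l y ihy =>
      simp only [List.nil_append, List.cons_append] at ihy ⊢
      rw [shAux_cons_cons, ihy, shAux_cons_cons n i l [] y, cst_cons_right n l [i] (y ++ [j])]
      simp only [shAux_nil_left, Finsupp.mapDomain_single, Finsupp.mapDomain_add,
        Finsupp.mapDomain_smul, ← Finsupp.mapDomain_comp, smul_add, smul_smul, List.cons_append,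
        Function.comp_def]
      abel
  | cons k x ihx =>
    induction y with
    | nil =>
      have h := ihx []
      simp only [List.nil_append, List.cons_append] at h ⊢
      rw [shAux_cons_cons, h, shAux_cons_cons n k j x [], ← List.cons_append (a := k) (as := x) (bs := [i]),
        cst_append_left n (k :: x)]
      simp only [shAux_nil_right, Finsupp.mapDomain_single, Finsupp.mapDomain_add,
        Finsupp.mapDomain_smul, ← Finsupp.mapDomain_comp, smul_add, smul_smul, List.cons_append,
        Function.comp_def, mul_comm]
      abel
    | cons l y ihy =>
      have h := ihx (l :: y)
      simp only [List.cons_append] at h ihy ⊢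
      rw [shAux_cons_cons, h, ihy, shAux_cons_cons n k l x, shAux_cons_cons n k l (x ++ [i]),
        ← List.cons_append (a := k) (as := x) (bs := [i]), cst_append_left n (k :: x), cst_cons_right n l [i] (y ++ [j])]
      simp only [Finsupp.mapDomain_add,
        Finsupp.mapDomain_smul, ← Finsupp.mapDomain_comp, smul_add, smul_smul, List.cons_append,
        Function.comp_def]
      rw [show cst n (k :: x) [l] * cst n [i] [l] * cst n [i] (y ++ [j])
        = cst n [i] [l] * cst n [i] (y ++ [j]) * cst n (k :: x) [l] by ring]
      abel

theorem shw_nil_left (n : ℕ) (y : List (Fin (n+2))) : shw n [] y = Finsupp.single y 1 := by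
  simp [shw, shAux_nil_left, Finsupp.mapDomain_single]

theorem shw_nil_right (n : ℕ) (x : List (Fin (n+2))) : shw n x [] = Finsupp.single x 1 := by
  simp [shw, shAux_nil_right, Finsupp.mapDomain_single]

/-- The recursion for the quantum shuffle product with respect to first letters. -/
theorem shw_cons_cons (n : ℕ) (i j : Fin (n+2)) (x y : List (Fin (n+2))) :
    shw n (i :: x) (j :: y) =
      cst n [i] (j :: y) • Finsupp.mapDomain (List.cons i) (shw n x (j :: y))
      + Finsupp.mapDomain (List.cons j) (shw n (i :: x) y) := by
  have h := shAux_append_append n i j x.reverse y.reverse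
  simp only [shw, List.reverse_cons]
  rw [h, ← List.reverse_cons, cst_reverse_right]
  simp only [Finsupp.mapDomain_add, Finsupp.mapDomain_smul, ← Finsupp.mapDomain_comp,
    Function.comp_def, List.reverse_append, List.reverse_singleton, List.singleton_append]

theorem mapDomain_cons_apply (n : ℕ) (i k : Fin (n+2)) (f : F n) (v : List (Fin (n+2))) :
    Finsupp.mapDomain (List.cons i) f (k :: v) = if i = k then f v else 0 := by
  split_ifs with h
  · subst h; exact Finsupp.mapDomain_apply (List.cons_injective) f v
  · refine Finsupp.mapDomain_of_notMem_range f _ ?_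
    rintro ⟨u, hu⟩
    exact h (List.cons.inj hu).1

theorem mapDomain_cons_apply_nil (n : ℕ) (i : Fin (n+2)) (f : F n) :
    Finsupp.mapDomain (List.cons i) f [] = 0 := by
  refine Finsupp.mapDomain_of_notMem_range f _ ?_
  rintro ⟨u, hu⟩
  exact List.cons_ne_nil _ _ hu

theorem shw_cons_cons_apply (n : ℕ) (i j k : Fin (n+2)) (x y v : List (Fin (n+2))) :
    shw n (i :: x) (j :: y) (k :: v) =
      cst n [i] (j :: y) * (if i = k then shw n x (j :: y) v else 0)
      + (if j = k then shw n (i :: x) y v else 0) := by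
  rw [shw_cons_cons, Finsupp.add_apply, Finsupp.smul_apply, mapDomain_cons_apply,
    mapDomain_cons_apply, smul_eq_mul]

/-- Every word occurring in a shuffle product starts with the first letter of one of the factors
and continues with a word occurring in the shuffle product of the remainders. -/
theorem exists_of_shw_cons_cons_ne_zero {n : ℕ} {i j : Fin (n+2)} {x y v : List (Fin (n+2))}
    (h : shw n (i :: x) (j :: y) v ≠ 0) :
    ∃ u, (v = i :: u ∧ shw n x (j :: y) u ≠ 0) ∨ (v = j :: u ∧ shw n (i :: x) y u ≠ 0) := by
  cases v with
  | nil =>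
    rw [shw_cons_cons, Finsupp.add_apply, Finsupp.smul_apply, mapDomain_cons_apply_nil,
      mapDomain_cons_apply_nil] at h
    simp at h
  | cons k u =>
    rw [shw_cons_cons_apply] at h
    refine ⟨u, ?_⟩
    by_contra! hc
    apply h
    rw [ite_eq_right_iff.mpr, ite_eq_right_iff.mpr, mul_zero, add_zero]
    · rintro rfl; exact hc.2 rfl
    · rintro rfl; exact hc.1 rfl

theorem length_and_discSum_of_shw_ne_zero {n : ℕ} {β : ℚ} {c : Fin (n+2) → ℚ} (hβ0 : 0 ≤ β)
    (hβ1 : β ≤ 1) (x y : List (Fin (n+2))) {v : List (Fin (n+2))} (h : shw n x y v ≠ 0) :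
    v.length = x.length + y.length ∧ discSum β c v ≤ discMax β c x + discMax β c y := by
  have hself : ∀ l : List (Fin (n+2)), discSum β c l ≤ discMax β c l := by
    intro l
    induction l with
    | nil => simp [discSum, discMax]
    | cons a l ih =>
      refine le_trans ?_ (le_max_right _ _)
      simp only [discSum]
      gcongr
  induction x generalizing y v with
  | nil =>
    rw [shw_nil_left, Finsupp.single_apply_ne_zero] at h
    simpa [h.1, discMax] using hself y
  | cons i x ihx =>
    induction y generalizing v with
    | nil =>
      rw [shw_nil_right, Finsupp.single_apply_ne_zero] at h
      simpa [h.1, discMax] using hself (i :: x)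
    | cons j y ihy =>
      have hx0 := discMax_nonneg β c (i :: x)
      have hy0 := discMax_nonneg β c (j :: y)
      obtain ⟨u, ⟨rfl, hu⟩ | ⟨rfl, hu⟩⟩ := exists_of_shw_cons_cons_ne_zero h
      · obtain ⟨h1, h2⟩ := ihx _ hu
        refine ⟨by simp [h1]; omega, ?_⟩
        have h3 : c i + β * discMax β c x ≤ discMax β c (i :: x) := le_max_right _ _
        simp only [discSum]
        nlinarith
      · obtain ⟨h1, h2⟩ := ihy hu
        refine ⟨by simp [h1]; omega, ?_⟩
        have h3 : c j + β * discMax β c y ≤ discMax β c (j :: y) := le_max_right _ _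
        simp only [discSum]
        nlinarith

theorem rep_succ (n m : ℕ) (w : List (Fin (n+2))) : rep n (m+1) w = w ++ rep n m w := by
  simp [rep, List.replicate_succ]

theorem rep_zero (n : ℕ) (w : List (Fin (n+2))) : rep n 0 w = [] := rfl

theorem length_rep (n m : ℕ) (w : List (Fin (n+2))) : (rep n m w).length = m * w.length := by
  simp [rep]

theorem pw_rep (n m : ℕ) (w : List (Fin (n+2))) : pw n (rep n m w) = m * pw n w := by
  induction m with
  | zero => simp [rep, pw]
  | succ m ih => rw [rep_succ, pw_append, ih]; ring

section Weighted

variable {n : ℕ} {β : ℚ} {c : Fin (n+2) → ℚ} {w : List (Fin (n+2))}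

theorem discSum_rep (h0 : discSum β c w = 0) (m : ℕ) : discSum β c (rep n m w) = 0 := by
  induction m with
  | zero => rfl
  | succ m ih => rw [rep_succ, discSum_append, h0, ih]; simp

theorem discSum_append_rep (h0 : discSum β c w = 0) (s : List (Fin (n+2))) (m : ℕ) :
    discSum β c (s ++ rep n m w) = discSum β c s := by
  rw [discSum_append, discSum_rep h0]; simp

theorem discSum_nonpos_of_prefix_rep (hβ0 : 0 < β) (h0 : discSum β c w = 0)
    (hpos : ∀ s t, w = s ++ t → s ≠ [] → t ≠ [] → 0 < discSum β c t) (m : ℕ)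
    {l : List (Fin (n+2))} (hl : l <+: rep n m w) : discSum β c l ≤ 0 := by
  induction m generalizing l with
  | zero =>
    rw [rep_zero, List.prefix_nil] at hl
    simp [hl, discSum]
  | succ m ih =>
    rw [rep_succ] at hl
    rcases List.prefix_or_prefix_of_prefix hl (List.prefix_append w _) with ⟨t, ht⟩ | ⟨l', rfl⟩
    · rcases eq_or_ne l [] with rfl | hl0
      · exact le_rfl
      rcases eq_or_ne t [] with rfl | ht0
      · rw [List.append_nil] at ht
        rw [ht, h0]
      have h1 := mul_pos (pow_pos hβ0 l.length) (hpos l t ht.symm hl0 ht0)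
      rw [← ht, discSum_append] at h0
      linarith
    · have h1 := ih ((List.prefix_append_right_inj w).mp hl)
      rw [discSum_append, h0, zero_add]
      exact mul_nonpos_of_nonneg_of_nonpos (by positivity) h1

theorem discMax_append_rep_le (hβ0 : 0 < β) (h0 : discSum β c w = 0)
    (hpos : ∀ s t, w = s ++ t → s ≠ [] → t ≠ [] → 0 < discSum β c t) (m : ℕ)
    {x s : List (Fin (n+2))} (hw : w = x ++ s) :
    discMax β c (s ++ rep n m w) ≤ discSum β c s := by
  obtain ⟨l, hl, h⟩ := exists_prefix_discMax_eq β c (s ++ rep n m w)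
  rw [h]
  have h1 : discSum β c (x ++ l) ≤ 0 := by
    refine discSum_nonpos_of_prefix_rep hβ0 h0 hpos (m+1) ?_
    rw [rep_succ]
    nth_rw 1 [hw]
    rw [List.append_assoc]
    exact (List.prefix_append_right_inj x).mpr hl
  have h2 : discSum β c x + β ^ x.length * discSum β c s = 0 := by
    rw [← discSum_append, ← hw, h0]
  rw [discSum_append] at h1
  exact le_of_mul_le_mul_left (by linarith) (pow_pos hβ0 x.length)

/-- A copy of `w` cannot be interrupted: the branch in which a shuffle of `w ^ m` with `w` leaves
the first factor in the middle of a copy of `w` contributes nothing to `w ^ (m+1)`. -/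
theorem shw_suffix_rep (hβ0 : 0 < β) (hβ1 : β < 1) (h0 : discSum β c w = 0)
    (hpos : ∀ s t, w = s ++ t → s ≠ [] → t ≠ [] → 0 < discSum β c t) (m : ℕ)
    {x s : List (Fin (n+2))} (hx : x ≠ []) (hw : w = x ++ s) :
    shw n (s ++ rep n m w) w (s ++ rep n (m+1) w)
      = cst n s w * shw n (rep n m w) w (rep n (m+1) w) := by
  induction s generalizing x with
  | nil => simp [cst_nil_left]
  | cons b s ih =>
    have hs := hpos x (b :: s) hw hx (by simp)
    obtain ⟨a, w', haw⟩ : ∃ a w', w = a :: w' :=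
      List.exists_cons_of_ne_nil (by simp [hw])
    have hzero : a = b → shw n (b :: s ++ rep n m w) w' (s ++ rep n (m+1) w) = 0 := by
      intro hab
      by_contra hne
      have h1 := (length_and_discSum_of_shw_ne_zero (c := c) hβ0.le hβ1.le _ _ hne).2
      have h2 := discMax_append_rep_le hβ0 h0 hpos m hw
      have h3 := discMax_append_rep_le hβ0 h0 hpos 0 (List.nil_append w).symm
      have h4 : c a + β * discMax β c w' ≤ discMax β c w := by
        rw [haw]; exact le_max_right _ _
      rw [rep_zero, List.append_nil, h0] at h3
      have h5 := discSum_append_rep h0 (b :: s) (m+1)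
      rw [List.cons_append, discSum, ← hab] at h5
      rw [hab] at h5 h4
      nlinarith
    have hstep := ih (x := x ++ [b]) (by simp) (by simp [hw])
    have hrec := shw_cons_cons_apply n b a b (s ++ rep n m w) w' (s ++ rep n (m+1) w)
    rw [← haw, if_pos rfl, hstep, ← List.cons_append, ite_eq_right_iff.mpr hzero] at hrec
    rw [List.cons_append (bs := rep n (m+1) w), hrec, cst_cons_left n b s]
    ring

theorem shw_rep_suffix (hβ0 : 0 < β) (hβ1 : β < 1) (h0 : discSum β c w = 0)
    (hpos : ∀ s t, w = s ++ t → s ≠ [] → t ≠ [] → 0 < discSum β c t) (m : ℕ)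
    {x s : List (Fin (n+2))} (hx : x ≠ []) (hw : w = x ++ s) :
    shw n (rep n m w) s (s ++ rep n m w) = 1 := by
  cases m with
  | zero => simp [rep_zero, shw_nil_left]
  | succ m =>
  induction s generalizing x with
  | nil => simp [shw_nil_right]
  | cons b s ih =>
    have hs := hpos x (b :: s) hw hx (by simp)
    obtain ⟨a, w', haw⟩ : ∃ a w', w = a :: w' :=
      List.exists_cons_of_ne_nil (by simp [hw])
    have hrep : rep n (m+1) w = a :: (w' ++ rep n m w) := by
      rw [rep_succ]; nth_rw 1 [haw]; rfl
    have hzero : a = b → shw n (w' ++ rep n m w) (b :: s) (s ++ rep n (m+1) w) = 0 := by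
      intro hab
      by_contra hne
      have h1 := (length_and_discSum_of_shw_ne_zero (c := c) hβ0.le hβ1.le _ _ hne).2
      have h2 := discMax_append_rep_le hβ0 h0 hpos 0 hw
      have h3 := discMax_append_rep_le hβ0 h0 hpos m (List.nil_append w).symm
      have h4 : c a + β * discMax β c (w' ++ rep n m w) ≤ discMax β c (w ++ rep n m w) := by
        rw [← rep_succ, hrep]; exact le_max_right _ _
      rw [rep_zero, List.append_nil] at h2
      have h5 := discSum_append_rep h0 (b :: s) (m+1)
      rw [List.cons_append, discSum] at h5
      rw [hab] at h4
      nlinarith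
    have hstep := ih (x := x ++ [b]) (by simp) (by simp [hw])
    have hrec := shw_cons_cons_apply n a b b (w' ++ rep n m w) s (s ++ rep n (m+1) w)
    rw [← hrep, if_pos rfl, hstep, ite_eq_right_iff.mpr hzero, mul_zero, zero_add] at hrec
    exact hrec

theorem shw_rep_succ (hβ0 : 0 < β) (hβ1 : β < 1) (h0 : discSum β c w = 0)
    (hpos : ∀ s t, w = s ++ t → s ≠ [] → t ≠ [] → 0 < discSum β c t) (hw : w ≠ []) (m : ℕ) :
    shw n (rep n (m+1) w) w (rep n (m+1+1) w)
      = cst n w w * shw n (rep n m w) w (rep n (m+1) w) + 1 := by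
  obtain ⟨a, w', haw⟩ := List.exists_cons_of_ne_nil hw
  have hrep : ∀ k, rep n (k+1) w = a :: (w' ++ rep n k w) := by
    intro k; rw [rep_succ]; nth_rw 1 [haw]; rfl
  have hrec := shw_cons_cons_apply n a a a (w' ++ rep n m w) w' (w' ++ rep n (m+1) w)
  rw [← hrep, ← hrep, ← haw, if_pos rfl, if_pos rfl,
    shw_suffix_rep hβ0 hβ1 h0 hpos m (List.cons_ne_nil a []) haw,
    shw_rep_suffix hβ0 hβ1 h0 hpos (m+1) (List.cons_ne_nil a []) haw] at hrec
  rw [hrec, ← mul_assoc, ← cst_cons_left, ← haw]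

end Weighted

theorem shw_rep_apply {n : ℕ} {w : List (Fin (n+2))} (hw : IsLyndonW n w) (m : ℕ) :
    shw n (rep n m w) w (rep n (m+1) w) = ∑ k ∈ Finset.range (m+1), cst n w w ^ k := by
  obtain ⟨β, c, hβ0, hβ1, h0, hpos, -⟩ := hw.exists_weight
  induction m with
  | zero => simp [rep_zero, rep_succ, shw_nil_left]
  | succ m ih => rw [shw_rep_succ hβ0 hβ1 h0 hpos hw.1, ih, geom_sum_succ (n := m + 1)]

theorem eq_or_wlt_of_shw_rep_ne_zero {n : ℕ} {w : List (Fin (n+2))} (hw : IsLyndonW n w) (m : ℕ)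
    {v : List (Fin (n+2))} (hv : shw n (rep n m w) w v ≠ 0) :
    v = rep n (m+1) w ∨ wlt n v (rep n (m+1) w) := by
  obtain ⟨β, c, hβ0, hβ1, h0, hpos, hmono⟩ := hw.exists_weight
  obtain ⟨hlen, hle⟩ := length_and_discSum_of_shw_ne_zero (c := c) hβ0.le hβ1.le _ _ hv
  have hlen' : v.length = (rep n (m+1) w).length := by
    rw [hlen, length_rep, length_rep]; ring
  have h1 := discMax_append_rep_le hβ0 h0 hpos m (List.append_nil w).symm
  have h2 := discMax_append_rep_le hβ0 h0 hpos 0 (List.nil_append w).symm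
  rw [List.nil_append, discSum] at h1
  rw [rep_zero, List.append_nil, h0] at h2
  rcases eq_or_lex_or_lex hlen' with h | h | h
  · exact .inl h
  · exact .inr h
  · have h3 := hmono _ _ hlen'.symm h
    rw [discSum_rep h0] at h3
    linarith

theorem bil_self (n : ℕ) (μ : Fin (n+2) → ℕ) :
    ∃ r : ℤ, 0 ≤ r ∧ bil n μ μ = 2 * ((μ 0 : ℤ) ^ 2 + r) ∧ (μ 0 = 0 → r = 0 → μ = 0) := by
  induction n with
  | zero =>
    refine ⟨((μ 0 : ℤ) - μ 1) ^ 2, sq_nonneg _, ?_, ?_⟩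
    · simp [bil, cart, Fin.sum_univ_two]; ring
    · intro h h'
      have h1 : (μ 1 : ℤ) = 0 := by simpa [h] using h'
      funext k
      fin_cases k
      · exact h
      · exact_mod_cast h1
  | succ n ih =>
    obtain ⟨r, hr, hb, hz⟩ := ih (fun k => μ k.succ)
    refine ⟨((μ 0 : ℤ) - μ 1) ^ 2 + r, by positivity, ?_, ?_⟩
    · have h00 : cart (n+1) 0 0 = 4 := by simp [cart]
      have h0s : ∀ j : Fin (n+2), cart (n+1) 0 j.succ = if j = 0 then -2 else 0 := by
        intro j
        by_cases hj : j = 0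
        · simp [cart, hj]
        · have : (j : ℕ) ≠ 0 := fun h => hj (Fin.ext h)
          simp [cart, hj, Fin.ext_iff, this]
      have hs0 : ∀ j : Fin (n+2), cart (n+1) j.succ 0 = if j = 0 then -2 else 0 := by
        intro j
        by_cases hj : j = 0
        · simp [cart, hj]
        · have : (j : ℕ) ≠ 0 := fun h => hj (Fin.ext h)
          simp [cart, hj, Fin.ext_iff, this]
      have hss : ∀ i j : Fin (n+2), cart (n+1) i.succ j.succ = cart n i j := by
        intro i j; simp [cart]
      have hexp : bil (n+1) μ μ
          = 4 * (μ 0 : ℤ) ^ 2 - 4 * μ 0 * μ 1 + bil n (fun k => μ k.succ) fun k => μ k.succ := by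
        simp only [bil]
        rw [Fin.sum_univ_succ, Fin.sum_univ_succ]
        simp only [Fin.sum_univ_succ (n := n+2) , h00, h0s, hs0, hss, mul_ite, mul_zero,
          Finset.sum_add_distrib, Finset.sum_ite_eq', Finset.mem_univ, if_true, Fin.succ_zero_eq_one]
        ring
      rw [hexp, hb]
      simp only [Fin.succ_zero_eq_one]
      ring
    · intro h h'
      have hsq := sq_nonneg ((μ 0 : ℤ) - μ 1)
      have hr0 : r = 0 := by linarith
      have h1 : (μ 1 : ℤ) = 0 := by
        have : ((μ 0 : ℤ) - μ 1) ^ 2 = 0 := by linarith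
        simpa [h] using this
      have ht := hz (by simpa using h1) hr0
      funext k
      refine Fin.cases h (fun j => congrFun ht j) k

theorem exists_bil_wt_self {n : ℕ} {w : List (Fin (n+2))} (hw : w ≠ []) :
    ∃ d : ℕ, 0 < d ∧ bil n (wt n w) (wt n w) = 2 * d := by
  obtain ⟨r, hr, hb, hz⟩ := bil_self n (wt n w)
  have hne : wt n w ≠ 0 := by
    obtain ⟨a, l, rfl⟩ := List.exists_cons_of_ne_nil hw
    intro h
    have := congrFun h a
    simp [wt] at this
  have hpos : 0 < (wt n w 0 : ℤ) ^ 2 + r := by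
    rcases Nat.eq_zero_or_pos (wt n w 0) with h | h
    · have : r ≠ 0 := fun h' => hne (hz h h')
      have : 0 < r := lt_of_le_of_ne hr this.symm
      positivity
    · positivity
  lift (wt n w 0 : ℤ) ^ 2 + r to ℕ using hpos.le with d hd
  exact ⟨d, by exact_mod_cast hpos, hb⟩

theorem qX_pow_ne_one {k : ℕ} (hk : 0 < k) : qX ^ k ≠ 1 := by
  intro h
  rw [qX, ← RatFunc.algebraMap_X, ← map_pow, ← map_one (algebraMap (Polynomial ℚ) (RatFunc ℚ))] at h
  have h' := congrArg Polynomial.natDegree (RatFunc.algebraMap_injective ℚ h)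
  simp at h'
  omega

theorem qint_eq (n : ℕ) (w : List (Fin (n+2))) (m : ℕ) :
    qint n w m = (((-1) ^ pw n w * qI n w) ^ m - (qI n w)⁻¹ ^ m)
      / ((-1) ^ pw n w * qI n w - (qI n w)⁻¹) := by
  rw [qint]
  split_ifs with h
  · rw [Even.neg_one_pow (Nat.even_iff.mpr h), one_mul]
  · rw [Odd.neg_one_pow (Nat.odd_iff.mpr (by omega)), neg_one_mul]

theorem cst_self {n : ℕ} {w : List (Fin (n+2))} (hw : w ≠ []) :
    cst n w w = (-1) ^ pw n w * (qI n w ^ 2)⁻¹ := by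
  obtain ⟨d, -, hd⟩ := exists_bil_wt_self hw
  have hp : (-1 : Kq) ^ (pw n w * pw n w) = (-1) ^ pw n w := by
    rcases Nat.even_or_odd (pw n w) with h | h
    · rw [h.neg_one_pow, (h.mul_left _).neg_one_pow]
    · rw [h.neg_one_pow, (h.mul h).neg_one_pow]
  rw [cst, hp, qI, hd, Int.mul_ediv_cancel_left _ two_ne_zero, zpow_neg, mul_comm 2, zpow_mul,
    zpow_ofNat]

theorem cst_self_pow_ne_one {n : ℕ} {w : List (Fin (n+2))} (hw : w ≠ []) {k : ℕ} (hk : 0 < k) :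
    cst n w w ^ k ≠ 1 := by
  obtain ⟨d, hd0, hd⟩ := exists_bil_wt_self hw
  intro h
  have hq : qI n w = qX ^ d := by
    rw [qI, hd, Int.mul_ediv_cancel_left _ two_ne_zero, zpow_natCast]
  have hε : ((-1 : Kq) ^ pw n w) ^ 2 = 1 := by rw [← pow_mul, mul_comm, pow_mul]; simp
  have h2 : (qX ^ (d * (4 * k)))⁻¹ = 1 := by
    calc (qX ^ (d * (4 * k)))⁻¹
        = (((-1 : Kq) ^ pw n w) ^ 2) ^ k * (((qX ^ d) ^ 2)⁻¹ ^ k) ^ 2 := by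
          rw [hε, one_pow, one_mul, inv_pow, inv_pow, ← pow_mul, ← pow_mul, ← pow_mul]
          ring_nf
      _ = (cst n w w ^ k) ^ 2 := by rw [cst_self hw, hq]; ring
      _ = 1 := by rw [h, one_pow]
  exact qX_pow_ne_one (by positivity) (inv_eq_one.mp h2)

/-- Let `𝐢` be a Lyndon word and `m > 0`.  Then
`max(𝐢^m ⋄ 𝐢) = 𝐢^{m+1}`, and the coefficient of the word `𝐢^{m+1}` in `𝐢^m ⋄ 𝐢`
equals `(-1)^{p(m𝐢)} q_𝐢^{-m} [m+1]_𝐢`. -/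
theorem stmt12 (n m : ℕ) (hm : 0 < m) (i : List (Fin (n+2))) (hi : IsLyndonW n i) :
    IsMaxWord n (shw n (rep n m i) i) (rep n (m+1) i) ∧
    (shw n (rep n m i) i) (rep n (m+1) i)
      = (-1 : Kq) ^ (pw n (rep n m i)) * (qI n i) ^ (-(m : ℤ)) * qint n i (m+1) := by
  have hw := hi.1
  have hone : (1 : Kq) - cst n i i ≠ 0 := by
    have := cst_self_pow_ne_one hw one_pos
    rw [pow_one] at this
    exact sub_ne_zero.mpr this.symm
  have hgeom : (∑ k ∈ Finset.range (m+1), cst n i i ^ k) * (1 - cst n i i)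
      = 1 - cst n i i ^ (m+1) := geom_sum_mul_neg _ _
  rw [IsMaxWord, Finsupp.mem_support_iff, shw_rep_apply hi]
  refine ⟨⟨?_, fun v hv => eq_or_wlt_of_shw_rep_ne_zero hi m (Finsupp.mem_support_iff.mp hv)⟩, ?_⟩
  · intro h
    rw [h, zero_mul] at hgeom
    exact cst_self_pow_ne_one hw m.succ_pos (sub_eq_zero.mp hgeom.symm).symm
  · have hQ : qI n i ≠ 0 := zpow_ne_zero _ qX_ne_zero
    have hε : ((-1 : Kq) ^ pw n i) ^ 2 = 1 := by rw [← pow_mul, mul_comm, pow_mul]; simp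
    rw [qint_eq, pw_rep, mul_comm m, pow_mul, eq_div_of_mul_eq hone hgeom]
    rw [cst_self hw] at hone ⊢
    generalize (-1 : Kq) ^ pw n i = ε at hε hone ⊢
    generalize qI n i = Q at hQ hone ⊢
    have hden : ε * Q - Q⁻¹ = ε * Q * (1 - ε * (Q ^ 2)⁻¹) := by
      field_simp
      linear_combination hε
    have hε0 : ε ≠ 0 := by rintro rfl; simp at hε
    have hnum : ε ^ m * Q ^ (-(m : ℤ)) * ((ε * Q) ^ (m+1) - Q⁻¹ ^ (m+1))
        = ε * Q * (1 - (ε * (Q ^ 2)⁻¹) ^ (m+1)) := by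
      have hεm : ε ^ (m+1) * ε ^ (m+1) = 1 := by
        rw [← pow_add, ← two_mul, pow_mul, hε, one_pow]
      rw [zpow_neg, zpow_natCast, mul_pow, mul_pow, inv_pow, inv_pow]
      have h1 : ε ^ m = ε * ε ^ (m+1) := by rw [pow_succ]; linear_combination (-ε ^ m) * hε
      rw [h1]
      generalize ε ^ (m+1) = δ at hεm
      rw [← pow_mul, mul_comm 2, pow_mul, pow_succ]
      field_simp
      linear_combination Q ^ 2 * (Q ^ m) ^ 2 * hεm
    rw [← mul_div_assoc, hnum, hden, mul_div_mul_left _ _ (mul_ne_zero hε0 hQ)]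

end SpinQHA
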